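/- arXiv:1102.1136 — 2 statements merged into one kernel-verified Lean document; each statement's English description precedes it below -/
import Mathlib

section
/- Let φ : [0,+∞] → [0,+∞] be an increasing function such that ∫_1^{+∞} dt/(φ(t))^{1/(n-1)} < +∞. Let F : D → [0,+∞] be upper semicontinuous and let 𝓕 be a family of nonnegative subharmonic functions u : D → [0,+∞) such that u(x) ≤ F(x) for all x ∈ D. If ∫_D φ(log⁺ F(x)) dm_n(x) < +∞, then w(x) := sup_{u ∈ 𝓕} u(x) is locally bounded above in D, and consequently its upper semicontinuous regularization w*(x) := limsup_{y→x} w(y) is subharmonic in D. -/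
open MeasureTheory Metric Filter Set ENNReal

noncomputable section

/-- The positive part of an extended real number, as an element of `ℝ≥0∞`. -/
def erealPos (x : EReal) : ℝ≥0∞ := if x = ⊤ then ⊤ else ENNReal.ofReal x.toReal

/-- `ν_n`, the Lebesgue measure of the unit ball of `ℝⁿ`. -/
def nuBall (n : ℕ) : ℝ := (volume (Metric.ball (0 : EuclideanSpace ℝ (Fin n)) 1)).toReal

/-- The (upper) integral `∫_A u dm_n` of an `EReal`-valued function, defined as the
lintegral of the positive part minus the lintegral of the negative part (an `EReal`). -/
def erealIntegralOn {n : ℕ} (A : Set (EuclideanSpace ℝ (Fin n)))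
    (u : EuclideanSpace ℝ (Fin n) → EReal) : EReal :=
  ((∫⁻ y in A, erealPos (u y) : ℝ≥0∞) : EReal) - ((∫⁻ y in A, erealPos (-(u y)) : ℝ≥0∞) : EReal)

/-- `u⁺ ∈ L¹_loc(D)`: the positive part of `u` has finite integral over every
compact subset of `D`. -/
def PosPartLocInt {n : ℕ} (u : EuclideanSpace ℝ (Fin n) → EReal)
    (D : Set (EuclideanSpace ℝ (Fin n))) : Prop :=
  ∀ E ⊆ D, IsCompact E → ∫⁻ x in E, erealPos (u x) < ⊤

/-- `u : D → [-∞, +∞)` is subharmonic on `D`: upper semicontinuous on `D`, never `+∞` on `D`,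
and satisfying the sub-mean-value inequality on every closed ball contained in `D`.
(The function `≡ -∞` satisfies this definition.) -/
def SubharmonicOn {n : ℕ} (u : EuclideanSpace ℝ (Fin n) → EReal)
    (D : Set (EuclideanSpace ℝ (Fin n))) : Prop :=
  UpperSemicontinuousOn u D ∧ (∀ x ∈ D, u x < ⊤) ∧
  ∀ x r, 0 < r → closedBall x r ⊆ D →
    u x ≤ ((1 / (nuBall n * r ^ n) : ℝ) : EReal) * erealIntegralOn (ball x r) u

/-- `u : D → [-∞, +∞)` is nearly subharmonic on `D`. -/
def NearlySubharmonicOn {n : ℕ} (u : EuclideanSpace ℝ (Fin n) → EReal)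
    (D : Set (EuclideanSpace ℝ (Fin n))) : Prop :=
  Measurable (D.restrict u) ∧ (∀ x ∈ D, u x < ⊤) ∧ PosPartLocInt u D ∧
  ∀ x r, 0 < r → closedBall x r ⊆ D →
    u x ≤ ((1 / (nuBall n * r ^ n) : ℝ) : EReal) * erealIntegralOn (ball x r) u

/-- `u : D → [-∞, +∞)` is `K`-quasinearly subharmonic on `D`:
Lebesgue measurable, `u⁺ ∈ L¹_loc(D)`, and for every `M ≥ 0` the function
`u_M := max {u, -M} + M` satisfies the generalized sub-mean-value inequality with constant `K`
on every closed ball contained in `D`. -/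
def QNSubharmonicOn {n : ℕ} (K : ℝ) (u : EuclideanSpace ℝ (Fin n) → EReal)
    (D : Set (EuclideanSpace ℝ (Fin n))) : Prop :=
  Measurable (D.restrict u) ∧ (∀ x ∈ D, u x < ⊤) ∧ PosPartLocInt u D ∧
  ∀ M : ℝ, 0 ≤ M → ∀ x r, 0 < r → closedBall x r ⊆ D →
    erealPos ((u x ⊔ ((-M : ℝ) : EReal)) + ((M : ℝ) : EReal)) ≤
      ENNReal.ofReal (K / (nuBall n * r ^ n)) *
        ∫⁻ y in ball x r, erealPos ((u y ⊔ ((-M : ℝ) : EReal)) + ((M : ℝ) : EReal))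

/-- `u : D → [-∞, +∞)` is `K`-quasinearly subharmonic n.s. (in the narrow sense) on `D`. -/
def QNSubharmonicNSOn {n : ℕ} (K : ℝ) (u : EuclideanSpace ℝ (Fin n) → EReal)
    (D : Set (EuclideanSpace ℝ (Fin n))) : Prop :=
  Measurable (D.restrict u) ∧ (∀ x ∈ D, u x < ⊤) ∧ PosPartLocInt u D ∧
  ∀ x r, 0 < r → closedBall x r ⊆ D →
    u x ≤ ((K / (nuBall n * r ^ n) : ℝ) : EReal) * erealIntegralOn (ball x r) u

/-- `log⁺` on `[0, +∞]`. -/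
def logPlusE (t : ℝ≥0∞) : ℝ≥0∞ := if t = ⊤ then ⊤ else ENNReal.ofReal (Real.log t.toReal)

open scoped Topology

/-- Finitely many balls along a chain of points, each of radius at most `ρ k` or at most its own
`μ`-measure, cannot reach further than a constant times the total of the `ρ k` and the mass of
`μ`. -/
lemma dist_add_radius_le_of_chain {X : Type*} [PseudoMetricSpace X] [MeasurableSpace X]
    [OpensMeasurableSpace X] (μ : Measure X) [IsFiniteMeasure μ] (x : ℕ → X) (r ρ : ℕ → ℝ)
    (hr : ∀ k, 0 ≤ r k) (hd : ∀ k, dist (x (k + 1)) (x k) ≤ r k)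
    (h : ∀ k, r k ≤ ρ k ∨ ENNReal.ofReal (r k) ≤ μ (closedBall (x k) (r k))) (N : ℕ) :
    ENNReal.ofReal (dist (x N) (x 0) + r N) ≤
      2 * ∑' k, ENNReal.ofReal (ρ k) + 10 * μ univ := by
  set d : ℕ → ℝ := fun k => dist (x k) (x 0) with hddef
  have hstep : ∀ k, d (k + 1) ≤ d k + r k := fun k => by
    have := dist_triangle (x (k + 1)) (x k) (x 0)
    have := hd k
    simp only [hddef]; linarith
  have hcover : ∀ N : ℕ, ∀ s, 0 ≤ s → s ≤ d N + r N → ∃ k, d k ≤ s ∧ s ≤ d k + r k := by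
    intro N
    induction N with
    | zero => exact fun s hs hs' => ⟨0, by simpa [hddef] using hs, hs'⟩
    | succ N ih =>
      intro s hs hs'
      by_cases hsd : d (N + 1) ≤ s
      · exact ⟨_, hsd, hs'⟩
      · exact ih s hs ((not_le.1 hsd).le.trans (hstep N))
  obtain ⟨u, hut, hdisj, hu⟩ := Vitali.exists_disjoint_subfamily_covering_enlargement
    (fun k => closedBall (x k) (r k))
    {k | ENNReal.ofReal (r k) ≤ μ (closedBall (x k) (r k))} r 2 one_lt_two (fun k _ => hr k)
    (μ univ).toReal
    (fun k hk => (ENNReal.ofReal_le_iff_le_toReal (measure_ne_top μ _)).1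
      (le_trans hk (measure_mono (subset_univ _))))
    (fun k _ => nonempty_closedBall.2 (hr k))
  have hsub : Icc 0 (d N + r N) ⊆ (⋃ k, Icc (d k - ρ k) (d k + ρ k)) ∪
      ⋃ k : u, Icc (d k - 5 * r k) (d k + 5 * r k) := by
    rintro s ⟨hs, hs'⟩
    obtain ⟨k, hk, hk'⟩ := hcover N s hs hs'
    have hrk := hr k
    rcases h k with hρ | hμ
    · exact Or.inl (mem_iUnion.2 ⟨k, by constructor <;> linarith⟩)
    · obtain ⟨b, hb, ⟨z, hzk, hzb⟩, hkb⟩ := hu k hμ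
      have h1 := dist_triangle (x k) (x b) (x 0)
      have h2 := dist_triangle (x b) (x k) (x 0)
      have h3 := dist_triangle_left (x k) (x b) z
      rw [mem_closedBall] at hzk hzb
      rw [dist_comm (x b) (x k)] at h2
      refine Or.inr (mem_iUnion.2 ⟨⟨b, hb⟩, ?_⟩)
      simp only [hddef] at hk hk' ⊢
      constructor <;> linarith
  have hvol : ∀ (y : ℝ) {R : ℝ}, volume (Icc (y - R) (y + R)) = 2 * ENNReal.ofReal R := by
    intro y R
    rw [Real.volume_Icc, show y + R - (y - R) = 2 * R by ring,
      ENNReal.ofReal_mul zero_le_two, ENNReal.ofReal_ofNat]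
  have hmass : ∑' k : u, ENNReal.ofReal (r k) ≤ μ univ := calc
    _ ≤ ∑' k : u, μ (closedBall (x k) (r k)) := ENNReal.tsum_le_tsum fun k => hut k.2
    _ ≤ μ univ := tsum_measure_le_measure_univ
        (fun _ => measurableSet_closedBall.nullMeasurableSet)
        fun i j hij => (hdisj i.2 j.2 (Subtype.coe_injective.ne hij)).aedisjoint
  calc ENNReal.ofReal (d N + r N) = volume (Icc 0 (d N + r N)) := by rw [Real.volume_Icc, sub_zero]
    _ ≤ (∑' k, volume (Icc (d k - ρ k) (d k + ρ k))) +
          ∑' k : u, volume (Icc (d k - 5 * r k) (d k + 5 * r k)) :=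
        (measure_mono hsub).trans ((measure_union_le _ _).trans
          (add_le_add (measure_iUnion_le _) (measure_iUnion_le _)))
    _ = 2 * ∑' k, ENNReal.ofReal (ρ k) + 10 * ∑' k : u, ENNReal.ofReal (r k) := by
        simp only [hvol, ENNReal.tsum_mul_left, ENNReal.ofReal_mul (show (0 : ℝ) ≤ 5 by norm_num),
          ENNReal.ofReal_ofNat]
        rw [← mul_assoc]
        norm_num
    _ ≤ _ := by gcongr

section EuclideanSpace

variable {n : ℕ}

lemma volume_ball_eq_pow (hn : n ≠ 0) (x : EuclideanSpace ℝ (Fin n)) {r : ℝ} (hr : 0 ≤ r) :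
    volume (ball x r) =
      ENNReal.ofReal r ^ n * volume (ball (0 : EuclideanSpace ℝ (Fin n)) 1) := by
  have : Nonempty (Fin n) := ⟨⟨0, Nat.pos_of_ne_zero hn⟩⟩
  rw [Measure.addHaar_ball _ _ hr, finrank_euclideanSpace_fin, ENNReal.ofReal_pow hr]

lemma ofReal_one_div_nuBall (hn : n ≠ 0) (x : EuclideanSpace ℝ (Fin n)) {r : ℝ} (hr : 0 < r) :
    ENNReal.ofReal (1 / (nuBall n * r ^ n)) = (volume (ball x r))⁻¹ := by
  have hV : volume (ball (0 : EuclideanSpace ℝ (Fin n)) 1) ≠ ⊤ := measure_ball_lt_top.ne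
  have hV0 : 0 < nuBall n :=
    ENNReal.toReal_pos (measure_ball_pos _ _ one_pos).ne' hV
  rw [volume_ball_eq_pow hn x hr.le, one_div, ENNReal.ofReal_inv_of_pos (by positivity),
    ENNReal.ofReal_mul hV0.le, ENNReal.ofReal_pow hr.le, mul_comm, nuBall,
    ENNReal.ofReal_toReal hV]

lemma erealIntegralOn_of_nonneg {A : Set (EuclideanSpace ℝ (Fin n))} (hA : MeasurableSet A)
    {v : EuclideanSpace ℝ (Fin n) → EReal} (hv : ∀ y ∈ A, 0 ≤ v y) :
    erealIntegralOn A v = ((∫⁻ y in A, erealPos (v y) : ℝ≥0∞) : EReal) := by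
  have h : ∫⁻ y in A, erealPos (-(v y)) = 0 := by
    rw [setLIntegral_congr_fun hA (g := fun _ => 0), lintegral_zero]
    intro y hy
    exact EReal.toENNReal_of_nonpos (by simpa using hv y hy)
  rw [erealIntegralOn, h]
  simp

/-- For a nonnegative function, the sub-mean-value inequality in terms of `ℝ≥0∞`. -/
lemma le_mean_iff_of_nonneg (hn : n ≠ 0) {x : EuclideanSpace ℝ (Fin n)} {r : ℝ} (hr : 0 < r)
    {v : EuclideanSpace ℝ (Fin n) → EReal} (hv : ∀ y ∈ ball x r, 0 ≤ v y) {a : EReal}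
    (ha : 0 ≤ a) :
    a ≤ ((1 / (nuBall n * r ^ n) : ℝ) : EReal) * erealIntegralOn (ball x r) v ↔
      erealPos a ≤ (volume (ball x r))⁻¹ * ∫⁻ y in ball x r, erealPos (v y) := by
  have hc : ((1 / (nuBall n * r ^ n) : ℝ) : EReal) = ((volume (ball x r))⁻¹ : ℝ≥0∞) := by
    rw [← ofReal_one_div_nuBall hn x hr, EReal.coe_ennreal_ofReal, max_eq_left]
    have : 0 ≤ nuBall n := ENNReal.toReal_nonneg
    positivity
  rw [erealIntegralOn_of_nonneg measurableSet_ball hv, hc, ← EReal.coe_ennreal_mul,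
    ← EReal.coe_ennreal_le_coe_ennreal_iff (x := erealPos a)]
  rw [show (erealPos a : EReal) = a from EReal.coe_toENNReal ha]

lemma SubharmonicOn.ofReal_le_mean (hn : n ≠ 0) {D : Set (EuclideanSpace ℝ (Fin n))}
    {u : EuclideanSpace ℝ (Fin n) → ℝ} (hu : SubharmonicOn (fun x => ((u x : ℝ) : EReal)) D)
    (hu0 : ∀ x ∈ D, 0 ≤ u x) {x : EuclideanSpace ℝ (Fin n)} {r : ℝ} (hr : 0 < r)
    (hx : closedBall x r ⊆ D) :
    ENNReal.ofReal (u x) ≤ (volume (ball x r))⁻¹ * ∫⁻ y in ball x r, ENNReal.ofReal (u y) :=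
  (le_mean_iff_of_nonneg hn hr
    (fun y hy => EReal.coe_nonneg.2 (hu0 y (hx (ball_subset_closedBall hy))))
    (EReal.coe_nonneg.2 (hu0 x (hx (mem_closedBall_self hr.le))))).1 (hu.2.2 x r hr hx)

/-- If a nonnegative subharmonic function exceeds the level `exp 1 * a` at the centre of a ball in
which it is at most `a` outside a set of relative measure at most `1 / 5`, then it reaches the
level `exp 2 * a` in the ball. -/
lemma SubharmonicOn.exists_exp_two_mul_le (hn : n ≠ 0) {D : Set (EuclideanSpace ℝ (Fin n))}
    {u : EuclideanSpace ℝ (Fin n) → ℝ} (hu : SubharmonicOn (fun x => ((u x : ℝ) : EReal)) D)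
    (hu0 : ∀ x ∈ D, 0 ≤ u x) {x : EuclideanSpace ℝ (Fin n)} {r : ℝ} (hr : 0 < r)
    (hx : closedBall x r ⊆ D) {E : Set (EuclideanSpace ℝ (Fin n))} (hE : MeasurableSet E)
    {a : ℝ} (ha : 0 < a) (hua : ∀ y ∈ ball x r, y ∉ E → u y ≤ a)
    (hvol : volume (E ∩ ball x r) ≤ volume (ball x r) / 5) (hux : Real.exp 1 * a ≤ u x) :
    ∃ y ∈ ball x r, Real.exp 2 * a ≤ u y := by
  by_contra! hcon
  have hB0 : volume (ball x r) ≠ 0 := (measure_ball_pos _ _ hr).ne'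
  have hB : volume (ball x r) ≠ ⊤ := measure_ball_lt_top.ne
  have hint : ∫⁻ y in ball x r, ENNReal.ofReal (u y) ≤
      volume (ball x r) * ENNReal.ofReal (a + Real.exp 2 * a / 5) := calc
    ∫⁻ y in ball x r, ENNReal.ofReal (u y)
      ≤ ∫⁻ y in ball x r, (ENNReal.ofReal a +
          E.indicator (fun _ => ENNReal.ofReal (Real.exp 2 * a)) y) := by
        refine setLIntegral_mono' measurableSet_ball fun y hy => ?_
        by_cases hyE : y ∈ E
        · rw [indicator_of_mem hyE]
          exact (ENNReal.ofReal_le_ofReal (hcon y hy).le).trans le_add_self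
        · exact (ENNReal.ofReal_le_ofReal (hua y hy hyE)).trans le_self_add
    _ = ENNReal.ofReal a * volume (ball x r) +
          ENNReal.ofReal (Real.exp 2 * a) * volume (E ∩ ball x r) := by
        rw [lintegral_add_left measurable_const, setLIntegral_const, lintegral_indicator_const hE,
          Measure.restrict_apply hE]
    _ ≤ ENNReal.ofReal a * volume (ball x r) +
          ENNReal.ofReal (Real.exp 2 * a) * (volume (ball x r) / 5) := by gcongr
    _ = _ := by
        rw [ENNReal.ofReal_add ha.le (by positivity), ENNReal.ofReal_div_of_pos (by norm_num),
          ENNReal.ofReal_ofNat, mul_add, mul_comm, ENNReal.div_eq_inv_mul, ENNReal.div_eq_inv_mul]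
        ring
  have hle : ENNReal.ofReal (u x) ≤ ENNReal.ofReal (a + Real.exp 2 * a / 5) := by
    refine (hu.ofReal_le_mean hn hu0 hr hx).trans ?_
    calc _ ≤ (volume (ball x r))⁻¹ *
          (volume (ball x r) * ENNReal.ofReal (a + Real.exp 2 * a / 5)) := by gcongr
      _ = _ := by rw [← mul_assoc, ENNReal.inv_mul_cancel hB0 hB, one_mul]
  rw [ENNReal.ofReal_le_ofReal_iff (by positivity)] at hle
  have h1 := Real.exp_one_gt_d9
  have h2 := Real.exp_one_lt_d9
  have h3 : Real.exp 2 = Real.exp 1 * Real.exp 1 := by rw [← Real.exp_add]; norm_num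
  have h4 : Real.exp 1 * a ≤ (1 + Real.exp 2 / 5) * a := by linarith
  have h5 := le_of_mul_le_mul_right h4 ha
  nlinarith

/-- The upper regularization of a family of nonnegative subharmonic functions that is locally
bounded above is subharmonic. -/
lemma subharmonicOn_limsup_iSup (hn : n ≠ 0) {D : Set (EuclideanSpace ℝ (Fin n))}
    {𝓕 : Set (EuclideanSpace ℝ (Fin n) → ℝ)}
    (h𝓕 : ∀ u ∈ 𝓕, (∀ x ∈ D, 0 ≤ u x) ∧ SubharmonicOn (fun x => ((u x : ℝ) : EReal)) D)
    (hbdd : ∀ x ∈ D, ∃ r > (0 : ℝ), ∃ C : ℝ, ∀ y ∈ closedBall x r ∩ D, ∀ u ∈ 𝓕, u y ≤ C) :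
    SubharmonicOn
      (fun x => Filter.limsup (fun y => ⨆ u ∈ 𝓕, ((u y : ℝ) : EReal)) (nhdsWithin x D)) D := by
  set w : EuclideanSpace ℝ (Fin n) → EReal := fun y => ⨆ u ∈ 𝓕, ((u y : ℝ) : EReal) with hw
  set W : EuclideanSpace ℝ (Fin n) → EReal := fun x => limsup w (𝓝[D] x) with hW
  have hle : ∀ y ∈ D, ∀ u ∈ 𝓕, (u y : EReal) ≤ W y := fun y hy u hu =>
    (le_iSup₂_of_le u hu le_rfl : (u y : EReal) ≤ w y).trans
      (le_limsup_of_frequently_le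
        ((frequently_pure.2 (le_refl (w y)) : ∃ᶠ z in pure y, w y ≤ w z).filter_mono
          (pure_le_nhdsWithin hy)))
  refine ⟨fun x hx c hc => ?_, fun x hx => ?_, fun x r hr hxr => ?_⟩
  · obtain ⟨b, hb, hbc⟩ := exists_between hc
    filter_upwards [eventually_eventually_nhdsWithin.2 (eventually_lt_of_limsup_lt hb)] with y hy
    exact (limsup_le_of_le (h := hy.mono fun _ h => h.le)).trans_lt hbc
  · obtain ⟨r, hr, C, hC⟩ := hbdd x hx
    refine lt_of_le_of_lt (limsup_le_of_le (a := (C : EReal)) (h := ?_)) (EReal.coe_lt_top C)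
    filter_upwards [self_mem_nhdsWithin, mem_nhdsWithin_of_mem_nhds (closedBall_mem_nhds x hr)]
      with y hyD hy
    exact iSup₂_le fun u hu => EReal.coe_le_coe_iff.2 (hC y ⟨hy, hyD⟩ u hu)
  · have hxD : x ∈ D := hxr (mem_closedBall_self hr.le)
    have : (𝓝[D] x).NeBot := mem_closure_iff_nhdsWithin_neBot.1 (subset_closure hxD)
    rcases 𝓕.eq_empty_or_nonempty with rfl | ⟨u₀, hu₀⟩
    · have : W x = ⊥ := by simp [hW, hw]
      exact this.trans_le bot_le
    have hW0 : ∀ y ∈ D, 0 ≤ W y := fun y hy =>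
      (EReal.coe_nonneg.2 ((h𝓕 u₀ hu₀).1 y hy)).trans (hle y hy u₀ hu₀)
    refine (le_mean_iff_of_nonneg hn hr
      (fun y hy => hW0 y (hxr (ball_subset_closedBall hy))) (hW0 x hxD)).2 ?_
    set I := ∫⁻ y in ball x r, erealPos (W y) with hI
    have hkey : ∀ y ∈ ball x r, w y ≤
        ((ENNReal.ofReal (1 / (nuBall n * (r - dist y x) ^ n)) * I : ℝ≥0∞) : EReal) := by
      intro y hy
      have hs : 0 < r - dist y x := sub_pos.2 hy
      have hsub : closedBall y (r - dist y x) ⊆ closedBall x r :=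
        closedBall_subset_closedBall' (by linarith)
      have hsub' : ball y (r - dist y x) ⊆ ball x r := ball_subset_ball' (by linarith)
      refine iSup₂_le fun u hu => ?_
      have hm := (h𝓕 u hu).2.ofReal_le_mean hn (h𝓕 u hu).1 hs (hsub.trans hxr)
      rw [← ofReal_one_div_nuBall hn y hs] at hm
      have hm' : ENNReal.ofReal (u y) ≤
          ENNReal.ofReal (1 / (nuBall n * (r - dist y x) ^ n)) * I := by
        refine hm.trans (mul_le_mul_right ?_ _)
        refine (lintegral_mono_set hsub').trans ?_
        refine setLIntegral_mono' measurableSet_ball fun z hz => ?_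
        exact EReal.toENNReal_le_toENNReal
          (hle z (hxr (ball_subset_closedBall hz)) u hu)
      refine le_trans ?_ (EReal.coe_ennreal_le_coe_ennreal_iff.2 hm')
      rw [EReal.coe_ennreal_ofReal]
      exact EReal.coe_le_coe_iff.2 (le_max_left _ _)
    have hν : 0 < nuBall n :=
      ENNReal.toReal_pos (measure_ball_pos _ _ one_pos).ne' measure_ball_lt_top.ne
    have htend : Tendsto (fun y => ((ENNReal.ofReal (1 / (nuBall n * (r - dist y x) ^ n)) * I :
        ℝ≥0∞) : EReal)) (𝓝[D] x) (𝓝 (((volume (ball x r))⁻¹ * I : ℝ≥0∞) : EReal)) := by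
      refine (continuous_coe_ennreal_ereal.tendsto _).comp ?_
      refine ENNReal.Tendsto.mul_const ?_ (Or.inl (by
        simpa using (measure_ball_lt_top (μ := volume) (x := x) (r := r)).ne))
      rw [← ofReal_one_div_nuBall hn x hr]
      refine (ENNReal.continuous_ofReal.tendsto _).comp (tendsto_nhdsWithin_of_tendsto_nhds ?_)
      have hcont : ContinuousAt (fun y => 1 / (nuBall n * (r - dist y x) ^ n)) x := by
        refine ContinuousAt.div continuousAt_const (by fun_prop) ?_
        simp only [dist_self, sub_zero]; positivity
      simpa using hcont.tendsto
    rw [← EReal.coe_ennreal_le_coe_ennreal_iff]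
    rw [show ((erealPos (limsup w (𝓝[D] x)) : ℝ≥0∞) : EReal) = W x from
      EReal.coe_toENNReal (hW0 x hxD), ← htend.limsup_eq]
    refine limsup_le_limsup ?_
    filter_upwards [mem_nhdsWithin_of_mem_nhds (ball_mem_nhds x hr)] with y hy using hkey y hy

lemma tsum_apply_le_lintegral_Ioi {g : ℝ → ℝ≥0∞} (hg : Antitone g) :
    ∑' k : ℕ, g (k + 2) ≤ ∫⁻ t in Ioi (1 : ℝ), g t := by
  have hdisj : Pairwise (Function.onFun Disjoint fun k : ℕ => Ioc ((k : ℝ) + 1) (k + 2)) := by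
    intro i j hij
    rw [Function.onFun, Set.disjoint_left]
    rintro t ⟨h1, h2⟩ ⟨h3, h4⟩
    have hij' : (i : ℝ) < j + 1 := by linarith
    have hji' : (j : ℝ) < i + 1 := by linarith
    norm_cast at hij' hji'
    omega
  calc ∑' k : ℕ, g (k + 2)
      ≤ ∑' k : ℕ, ∫⁻ t in Ioc ((k : ℝ) + 1) (k + 2), g t := by
        refine ENNReal.tsum_le_tsum fun k => ?_
        calc g (k + 2) = ∫⁻ _ in Ioc ((k : ℝ) + 1) (k + 2), g (k + 2) := by
              rw [setLIntegral_const, Real.volume_Ioc]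
              norm_num
          _ ≤ _ := setLIntegral_mono' measurableSet_Ioc fun t ht => hg ht.2
    _ = ∫⁻ t in ⋃ k : ℕ, Ioc ((k : ℝ) + 1) (k + 2), g t :=
        (lintegral_iUnion (fun _ => measurableSet_Ioc) hdisj g).symm
    _ ≤ _ := by
        refine lintegral_mono_set (iUnion_subset fun k t ht => ?_)
        have := ht.1
        have : (0 : ℝ) ≤ k := k.cast_nonneg
        simp only [mem_Ioi]; linarith

/-- A ball of radius at least `ρ` in which the set `E` of finite measure has small density, and
which has radius `ρ` unless the density is not too small. -/
lemma exists_radius_volume_inter_le (hn : n ≠ 0) {E : Set (EuclideanSpace ℝ (Fin n))}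
    (hE : volume E ≠ ⊤) {ρ : ℝ} (hρ : 0 < ρ) (x : EuclideanSpace ℝ (Fin n)) :
    ∃ r, ρ ≤ r ∧ volume (E ∩ ball x r) ≤ volume (ball x r) / 5 ∧
      (r ≤ ρ ∨ volume (ball x r) ≤ 5 * 2 ^ n * volume (E ∩ ball x r)) := by
  classical
  set V := volume (ball (0 : EuclideanSpace ℝ (Fin n)) 1)
  have hV0 : V ≠ 0 := (measure_ball_pos _ _ one_pos).ne'
  have hex : ∃ j : ℕ, volume (E ∩ ball x (2 ^ j * ρ)) ≤ volume (ball x (2 ^ j * ρ)) / 5 := by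
    have hlim : Tendsto (fun j : ℕ => ENNReal.ofReal (2 ^ j * ρ)) atTop (𝓝 ⊤) :=
      ENNReal.tendsto_ofReal_nhds_top.2
        ((tendsto_pow_atTop_atTop_of_one_lt (r := (2 : ℝ)) one_lt_two).atTop_mul_const hρ)
    have hlim' : Tendsto (fun j : ℕ => ENNReal.ofReal (2 ^ j * ρ) ^ n * V / 5) atTop (𝓝 ⊤) := by
      have h1 := ((ENNReal.continuous_pow n).tendsto ⊤).comp hlim
      rw [ENNReal.top_pow hn] at h1
      have h2 := ENNReal.Tendsto.mul_const (b := V) h1 (Or.inl ENNReal.top_ne_zero)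
      rw [ENNReal.top_mul hV0] at h2
      have h3 := ENNReal.Tendsto.div_const (b := 5) h2 (Or.inl ENNReal.top_ne_zero)
      rwa [ENNReal.top_div_of_ne_top (by norm_num)] at h3
    obtain ⟨j, hj⟩ := (hlim'.eventually (lt_mem_nhds hE.lt_top)).exists
    refine ⟨j, ?_⟩
    rw [volume_ball_eq_pow hn x (by positivity : (0 : ℝ) ≤ 2 ^ j * ρ)]
    exact (measure_mono inter_subset_left).trans hj.le
  refine ⟨2 ^ Nat.find hex * ρ, ?_, Nat.find_spec hex, ?_⟩
  · exact le_mul_of_one_le_left hρ.le (one_le_pow₀ one_le_two)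
  · rcases h : Nat.find hex with _ | j
    · left; simp
    · right
      have hj := Nat.find_min hex (show j < Nat.find hex by omega)
      have hdouble : volume (ball x (2 ^ (j + 1) * ρ)) = 2 ^ n * volume (ball x (2 ^ j * ρ)) := by
        rw [volume_ball_eq_pow hn x (by positivity), volume_ball_eq_pow hn x (by positivity),
          pow_succ', mul_assoc (2 : ℝ), ENNReal.ofReal_mul zero_le_two, ENNReal.ofReal_ofNat,
          mul_pow, mul_assoc]
      rw [not_le, ENNReal.div_lt_iff (by norm_num) (by norm_num)] at hj
      rw [hdouble]
      calc 2 ^ n * volume (ball x (2 ^ j * ρ))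
          ≤ 2 ^ n * (volume (E ∩ ball x (2 ^ j * ρ)) * 5) := by gcongr
        _ = 5 * 2 ^ n * volume (E ∩ ball x (2 ^ j * ρ)) := by ring
        _ ≤ _ := by
          refine mul_le_mul_right (measure_mono (inter_subset_inter_right _
            (ball_subset_ball ?_))) _
          gcongr
          · exact one_le_two
          · omega

/-- The part of `D` on which `F` is at least `exp k`. -/
def superlevelExp (D : Set (EuclideanSpace ℝ (Fin n))) (F : EuclideanSpace ℝ (Fin n) → ℝ≥0∞)
    (k : ℕ) : Set (EuclideanSpace ℝ (Fin n)) :=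
  {x ∈ D | ENNReal.ofReal (Real.exp k) ≤ F x}

lemma superlevelExp_antitone (D : Set (EuclideanSpace ℝ (Fin n)))
    (F : EuclideanSpace ℝ (Fin n) → ℝ≥0∞) : Antitone (superlevelExp D F) :=
  fun i j hij x hx => ⟨hx.1, le_trans (by gcongr) hx.2⟩

lemma measurableSet_superlevelExp {D : Set (EuclideanSpace ℝ (Fin n))} (hD : IsOpen D)
    {F : EuclideanSpace ℝ (Fin n) → ℝ≥0∞} (hF : UpperSemicontinuousOn F D) (k : ℕ) :
    MeasurableSet (superlevelExp D F k) := by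
  have hopen : IsOpen {x ∈ D | F x < ENNReal.ofReal (Real.exp k)} := by
    rw [isOpen_iff_mem_nhds]
    rintro x ⟨hxD, hx⟩
    have := hF x hxD _ hx
    rw [hD.nhdsWithin_eq hxD] at this
    filter_upwards [this, hD.mem_nhds hxD] with y hy hyD using ⟨hyD, hy⟩
  convert hD.measurableSet.diff hopen.measurableSet using 1
  ext x
  simp only [superlevelExp, mem_ofPred_eq, Set.mem_sdiff, not_and, not_lt]
  tauto

lemma natCast_le_logPlusE {t : ℝ≥0∞} {k : ℕ} (h : ENNReal.ofReal (Real.exp k) ≤ t) :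
    ENNReal.ofReal k ≤ logPlusE t := by
  unfold logPlusE
  split_ifs with ht
  · exact le_top
  · refine ENNReal.ofReal_le_ofReal ?_
    have h' := (ENNReal.ofReal_le_iff_le_toReal ht).1 h
    exact (Real.le_log_iff_exp_le ((Real.exp_pos _).trans_le h')).2 h'

lemma mul_volume_superlevelExp_inter_le {D : Set (EuclideanSpace ℝ (Fin n))} (hD : IsOpen D)
    {F : EuclideanSpace ℝ (Fin n) → ℝ≥0∞} (hF : UpperSemicontinuousOn F D)
    {φ : ℝ≥0∞ → ℝ≥0∞} (hφ : Monotone φ) (k : ℕ) {B : Set (EuclideanSpace ℝ (Fin n))}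
    (hB : MeasurableSet B) :
    φ (ENNReal.ofReal k) * volume (superlevelExp D F k ∩ B) ≤
      ∫⁻ x in superlevelExp D F k ∩ B, φ (logPlusE (F x)) := by
  rw [← setLIntegral_const]
  exact setLIntegral_mono' ((measurableSet_superlevelExp hD hF k).inter hB)
    fun x hx => hφ (natCast_le_logPlusE hx.1.2)

/-- Positive radii with finite total, calibrated by `φ`. -/
lemma exists_summable_radii (hn : 2 ≤ n) {φ : ℝ≥0∞ → ℝ≥0∞} (hφ : Monotone φ)
    (hφint : ∫⁻ t in Ioi (1 : ℝ), (φ (ENNReal.ofReal t) ^ (1 / ((n : ℝ) - 1)))⁻¹ < ⊤) :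
    ∃ ρ : ℕ → ℝ, (∀ k, 0 < ρ k) ∧ ∑' k, ENNReal.ofReal (ρ k) ≠ ⊤ ∧
      ∀ k : ℕ, 1 ≤ φ (ENNReal.ofReal (k + 2 : ℕ)) * ENNReal.ofReal (ρ k) ^ (n - 1) := by
  have hn1 : 0 < (n : ℝ) - 1 := by
    have : (2 : ℝ) ≤ n := by exact_mod_cast hn
    linarith
  set g : ℝ → ℝ≥0∞ := fun t => (φ (ENNReal.ofReal t) ^ (1 / ((n : ℝ) - 1)))⁻¹ with hg
  have hanti : Antitone g := fun s t hst => ENNReal.inv_le_inv.2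
    (ENNReal.rpow_le_rpow (hφ (ENNReal.ofReal_le_ofReal hst)) (by positivity))
  have hsum : ∑' k : ℕ, g (k + 2) ≠ ⊤ :=
    ((tsum_apply_le_lintegral_Ioi hanti).trans_lt hφint).ne
  have hfin : ∀ k : ℕ, g (k + 2) ≠ ⊤ := ENNReal.ne_top_of_tsum_ne_top hsum
  refine ⟨fun k => (g (k + 2)).toReal + (1 / 2) ^ k, fun k => by positivity, ?_, fun k => ?_⟩
  · have h1 : ∀ k : ℕ, ENNReal.ofReal ((g (k + 2)).toReal + (1 / 2) ^ k) =
        g (k + 2) + 2⁻¹ ^ k := fun k => by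
      rw [ENNReal.ofReal_add ENNReal.toReal_nonneg (by positivity), ENNReal.ofReal_toReal (hfin k),
        ENNReal.ofReal_pow (by norm_num), one_div, ENNReal.ofReal_inv_of_pos two_pos,
        ENNReal.ofReal_ofNat]
    simp only [h1]
    rw [ENNReal.tsum_add, ENNReal.add_ne_top]
    refine ⟨hsum, ?_⟩
    rw [ENNReal.tsum_geometric, ENNReal.one_sub_inv_two, inv_inv]
    exact ENNReal.ofNat_ne_top
  · push_cast
    set c := φ (ENNReal.ofReal ((k : ℝ) + 2)) with hc
    have hc0 : c ≠ 0 := fun h0 => hfin k (by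
      simp only [hg]
      rw [← hc, h0, ENNReal.zero_rpow_of_pos (by positivity), ENNReal.inv_zero])
    have hρ0 : ENNReal.ofReal ((g (k + 2)).toReal + (1 / 2) ^ k) ≠ 0 :=
      (ENNReal.ofReal_pos.2 (by positivity)).ne'
    by_cases hctop : c = ⊤
    · rw [hctop, ENNReal.top_mul (pow_ne_zero _ hρ0)]
      exact le_top
    · have hge : g (k + 2) ≤ ENNReal.ofReal ((g (k + 2)).toReal + (1 / 2) ^ k) := by
        conv_lhs => rw [← ENNReal.ofReal_toReal (hfin k)]
        exact ENNReal.ofReal_le_ofReal (le_add_of_nonneg_right (by positivity))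
      have hpow : g (k + 2) ^ (n - 1) = c⁻¹ := by
        simp only [hg]
        rw [← hc, ← ENNReal.inv_rpow, ← ENNReal.rpow_natCast, ← ENNReal.rpow_mul,
          Nat.cast_sub (by omega), Nat.cast_one, one_div_mul_cancel hn1.ne', ENNReal.rpow_one]
      calc (1 : ℝ≥0∞) = c * g (k + 2) ^ (n - 1) := by rw [hpow, ENNReal.mul_inv_cancel hc0 hctop]
        _ ≤ _ := by gcongr

lemma exists_lt_of_summable_radii (hn : 2 ≤ n) {c : ℕ → ℝ≥0∞} {ρ : ℕ → ℝ}
    (hρ : ∑' k, ENNReal.ofReal (ρ k) ≠ ⊤)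
    (hc : ∀ k, 1 ≤ c k * ENNReal.ofReal (ρ k) ^ (n - 1)) {A : ℝ≥0∞} (hA : A ≠ ⊤) :
    ∃ k, A < c k := by
  by_contra! hcon
  have hlim : Tendsto (fun k => A * ENNReal.ofReal (ρ k) ^ (n - 1)) atTop (𝓝 0) := by
    have h1 := ((ENNReal.continuous_pow (n - 1)).tendsto 0).comp
      (ENNReal.tendsto_atTop_zero_of_tsum_ne_top hρ)
    rw [zero_pow (by omega)] at h1
    simpa using ENNReal.Tendsto.const_mul (a := A) h1 (Or.inr hA)
  obtain ⟨k, hk⟩ := (hlim.eventually (gt_mem_nhds zero_lt_one)).exists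
  exact absurd ((hc k).trans (mul_le_mul_left (hcon k) _)) (not_le.2 hk)

lemma ofReal_le_mul_lintegral (hn : 2 ≤ n) {D : Set (EuclideanSpace ℝ (Fin n))} (hD : IsOpen D)
    {F : EuclideanSpace ℝ (Fin n) → ℝ≥0∞} (hF : UpperSemicontinuousOn F D)
    {φ : ℝ≥0∞ → ℝ≥0∞} (hφ : Monotone φ) {k : ℕ} {ρ r : ℝ} (hρ : 0 < ρ) (hρr : ρ ≤ r)
    (hφρ : 1 ≤ φ (ENNReal.ofReal k) * ENNReal.ofReal ρ ^ (n - 1))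
    {x : EuclideanSpace ℝ (Fin n)}
    (hvol : volume (ball x r) ≤ 5 * 2 ^ n * volume (superlevelExp D F k ∩ ball x r)) :
    ENNReal.ofReal r ≤ 5 * 2 ^ n / volume (ball (0 : EuclideanSpace ℝ (Fin n)) 1) *
      ∫⁻ y in superlevelExp D F k ∩ ball x r, φ (logPlusE (F y)) := by
  set V := volume (ball (0 : EuclideanSpace ℝ (Fin n)) 1)
  have hV0 : V ≠ 0 := (measure_ball_pos _ _ one_pos).ne'
  have hV : V ≠ ⊤ := measure_ball_lt_top.ne
  set c := φ (ENNReal.ofReal k)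
  calc ENNReal.ofReal r
      ≤ c * ENNReal.ofReal ρ ^ (n - 1) * ENNReal.ofReal r := le_mul_of_one_le_left' hφρ
    _ ≤ c * ENNReal.ofReal r ^ (n - 1) * ENNReal.ofReal r := by gcongr
    _ = c * (volume (ball x r) / V) := by
        rw [volume_ball_eq_pow (by omega) x (hρ.le.trans hρr), ENNReal.mul_div_cancel_right hV0 hV,
          mul_assoc, ← pow_succ, Nat.sub_add_cancel (by omega)]
    _ ≤ c * (5 * 2 ^ n * volume (superlevelExp D F k ∩ ball x r) / V) := by gcongr
    _ = 5 * 2 ^ n / V * (c * volume (superlevelExp D F k ∩ ball x r)) := by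
        simp only [div_eq_mul_inv]; ring
    _ ≤ _ := by
        gcongr
        exact mul_volume_superlevelExp_inter_le hD hF hφ k measurableSet_ball

lemma volume_iInter_superlevelExp (hn : 2 ≤ n) {D : Set (EuclideanSpace ℝ (Fin n))}
    (hD : IsOpen D) {F : EuclideanSpace ℝ (Fin n) → ℝ≥0∞} (hF : UpperSemicontinuousOn F D)
    {φ : ℝ≥0∞ → ℝ≥0∞} (hφ : Monotone φ) (hint : ∫⁻ x in D, φ (logPlusE (F x)) ≠ ⊤)
    {ρ : ℕ → ℝ} (hρ : ∑' k, ENNReal.ofReal (ρ k) ≠ ⊤)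
    (hφρ : ∀ k : ℕ, 1 ≤ φ (ENNReal.ofReal (k + 2 : ℕ)) * ENNReal.ofReal (ρ k) ^ (n - 1)) :
    volume (⋂ k, superlevelExp D F k) = 0 := by
  by_contra h0
  obtain ⟨k, hk⟩ := exists_lt_of_summable_radii hn hρ hφρ (ENNReal.div_ne_top hint h0)
  have h1 := mul_volume_superlevelExp_inter_le hD hF hφ (k + 2) MeasurableSet.univ
  rw [inter_univ] at h1
  have h2 : φ (ENNReal.ofReal (k + 2 : ℕ)) * volume (⋂ k, superlevelExp D F k) ≤
      ∫⁻ x in D, φ (logPlusE (F x)) :=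
    (mul_le_mul_right (measure_mono (iInter_subset _ _)) _).trans
      (h1.trans (lintegral_mono_set fun _ hx => hx.1))
  exact absurd (ENNReal.le_div_iff_mul_le (Or.inl h0) (Or.inr hint) |>.2 h2) (not_le.2 hk)

/-- A bound for all nonnegative subharmonic minorants of `F`, uniform over the points at distance
more than `δ` from the complement of `D`. -/
lemma exists_uniform_bound (hn : 2 ≤ n) {D : Set (EuclideanSpace ℝ (Fin n))} (hD : IsOpen D)
    {φ : ℝ≥0∞ → ℝ≥0∞} (hφ : Monotone φ)
    (hφint : ∫⁻ t in Ioi (1 : ℝ), (φ (ENNReal.ofReal t) ^ (1 / ((n : ℝ) - 1)))⁻¹ < ⊤)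
    {F : EuclideanSpace ℝ (Fin n) → ℝ≥0∞} (hF : UpperSemicontinuousOn F D)
    (hint : ∫⁻ x in D, φ (logPlusE (F x)) < ⊤) {δ : ℝ} (hδ : 0 < δ) :
    ∃ C : ℝ, ∀ u : EuclideanSpace ℝ (Fin n) → ℝ, (∀ x ∈ D, 0 ≤ u x) →
      SubharmonicOn (fun x => ((u x : ℝ) : EReal)) D →
      (∀ x ∈ D, ENNReal.ofReal (u x) ≤ F x) →
      ∀ y, closedBall y δ ⊆ D → u y ≤ C := by
  classical
  have hn0 : n ≠ 0 := by omega
  obtain ⟨ρ, hρ0, hρ, hφρ⟩ := exists_summable_radii hn hφ hφint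
  set V := volume (ball (0 : EuclideanSpace ℝ (Fin n)) 1)
  have hV0 : V ≠ 0 := (measure_ball_pos _ _ one_pos).ne'
  have hK : 5 * 2 ^ n / V ≠ ⊤ :=
    ENNReal.div_ne_top (ENNReal.mul_ne_top (by norm_num) (ENNReal.pow_ne_top (by norm_num))) hV0
  set K := 5 * 2 ^ n / V
  set E : ℕ → Set (EuclideanSpace ℝ (Fin n)) := superlevelExp D F with hE
  have hEmeas : ∀ k, MeasurableSet (E k) := measurableSet_superlevelExp hD hF
  set μ : Measure (EuclideanSpace ℝ (Fin n)) :=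
    K • (volume.restrict D).withDensity (fun x => φ (logPlusE (F x))) with hμ
  have hμuniv : μ univ ≠ ⊤ := by
    rw [hμ, Measure.smul_apply, withDensity_apply _ MeasurableSet.univ, Measure.restrict_univ]
    exact ENNReal.mul_ne_top hK hint.ne
  have : IsFiniteMeasure μ := ⟨hμuniv.lt_top⟩
  have hμE : Tendsto (fun k => μ (E (k + 2))) atTop (𝓝 0) := by
    have h1 := tendsto_measure_iInter_atTop (μ := μ) (fun k => (hEmeas k).nullMeasurableSet)
      (superlevelExp_antitone D F) ⟨0, measure_ne_top _ _⟩
    have h2 : μ (⋂ k, E k) = 0 := by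
      have h3 := volume_iInter_superlevelExp hn hD hF hφ hint.ne hρ hφρ
      have h4 : (volume.restrict D).withDensity (fun x => φ (logPlusE (F x))) (⋂ k, E k) = 0 :=
        withDensity_absolutelyContinuous _ _ (Measure.restrict_le_self.absolutelyContinuous h3)
      rw [hμ, Measure.smul_apply, h4, smul_zero]
    rw [h2] at h1
    exact h1.comp (tendsto_add_atTop_nat 2)
  have hsmall : Tendsto (fun m => 2 * ∑' k, ENNReal.ofReal (ρ (k + m)) + 10 * μ (E (m + 2)))
      atTop (𝓝 0) := by
    have h1 := ENNReal.Tendsto.const_mul (a := 2)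
      (ENNReal.tendsto_sum_nat_add (fun k => ENNReal.ofReal (ρ k)) hρ) (Or.inr (by norm_num))
    have h2 := ENNReal.Tendsto.const_mul (a := 10) hμE (Or.inr (by norm_num))
    simpa using h1.add h2
  obtain ⟨m, hm⟩ := (hsmall.eventually (gt_mem_nhds (ENNReal.ofReal_pos.2 hδ))).exists
  have hEfin : ∀ k, volume (E (k + 2)) ≠ ⊤ := fun k hk => by
    have h1 := mul_volume_superlevelExp_inter_le hD hF hφ (k + 2) MeasurableSet.univ
    rw [inter_univ, hk, ENNReal.mul_top] at h1
    · exact hint.ne (top_le_iff.1 (h1.trans (lintegral_mono_set fun _ hx => hx.1)))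
    · intro h0
      have := hφρ k
      rw [h0, zero_mul] at this
      exact absurd this (by norm_num)
  choose R hRρ hRsmall hRlarge using fun (k : ℕ) (x : EuclideanSpace ℝ (Fin n)) =>
    exists_radius_volume_inter_le hn0 (hEfin (k + m)) (hρ0 (k + m)) x
  have hR0 : ∀ k x, 0 < R k x := fun k x => (hρ0 _).trans_le (hRρ k x)
  have hR : ∀ k x, R k x ≤ ρ (k + m) ∨
      ENNReal.ofReal (R k x) ≤ μ.restrict (E (m + 2)) (closedBall x (R k x)) := by
    intro k x
    refine (hRlarge k x).imp_right fun h => ?_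
    refine (ofReal_le_mul_lintegral hn hD hF hφ (hρ0 _) (hRρ k x) (hφρ _) h).trans ?_
    rw [Measure.restrict_apply measurableSet_closedBall, hμ, Measure.smul_apply,
      withDensity_apply _ (measurableSet_closedBall.inter (hEmeas _)),
      Measure.restrict_restrict (measurableSet_closedBall.inter (hEmeas _)), smul_eq_mul]
    refine mul_le_mul_right (lintegral_mono_set ?_) _
    exact fun y hy => ⟨⟨ball_subset_closedBall hy.2,
      superlevelExp_antitone D F (by omega) hy.1⟩, hy.1.1⟩
  refine ⟨Real.exp (m + 3), fun u hu0 hu huF y hy => ?_⟩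
  by_contra! hcon
  set next : ℕ → EuclideanSpace ℝ (Fin n) → EuclideanSpace ℝ (Fin n) := fun k x =>
    if h : ∃ z ∈ ball x (R k x), Real.exp (k + m + 4) ≤ u z then h.choose else x with hnext
  set x : ℕ → EuclideanSpace ℝ (Fin n) := fun k => Nat.rec y next k with hx
  have hx1 : ∀ k, x (k + 1) = next k (x k) := fun _ => rfl
  have hstep : ∀ k, dist (x (k + 1)) (x k) ≤ R k (x k) := by
    intro k
    rw [hx1]
    simp only [hnext]
    split_ifs with h
    · exact (mem_ball.1 h.choose_spec.1).le
    · rw [dist_self]; exact (hR0 _ _).le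
  have hdist : ∀ k, dist (x k) y + R k (x k) < δ := by
    intro k
    have h1 := dist_add_radius_le_of_chain (μ.restrict (E (m + 2))) x (fun k => R k (x k))
      (fun k => ρ (k + m)) (fun k => (hR0 _ _).le) hstep (fun k => hR k (x k)) k
    rw [Measure.restrict_apply_univ] at h1
    exact (ENNReal.ofReal_lt_ofReal_iff hδ).1 (h1.trans_lt hm)
  have hball : ∀ k, closedBall (x k) (R k (x k)) ⊆ D := fun k =>
    (closedBall_subset_closedBall' (by linarith [hdist k])).trans hy
  have hux : ∀ k : ℕ, Real.exp (k + m + 3) ≤ u (x k) := by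
    intro k
    induction k with
    | zero => simpa [hx] using hcon.le
    | succ k ih =>
      have hlev : ∃ z ∈ ball (x k) (R k (x k)), Real.exp (k + m + 4) ≤ u z := by
        have h1 := hu.exists_exp_two_mul_le hn0 hu0 (hR0 k (x k)) (hball k) (hEmeas (k + m + 2))
          (Real.exp_pos ((k + m + 2 : ℕ) : ℝ)) (fun z hz hzE => ?_) (hRsmall k (x k))
          (by rw [← Real.exp_add]; convert ih using 2; push_cast; ring)
        · obtain ⟨z, hz, hz'⟩ := h1
          refine ⟨z, hz, ?_⟩
          rw [← Real.exp_add] at hz'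
          convert hz' using 2
          push_cast; ring
        · have hzD := hball k (ball_subset_closedBall hz)
          by_contra! hlt
          exact hzE ⟨hzD, (ENNReal.ofReal_le_ofReal hlt.le).trans (huF z hzD)⟩
      rw [hx1]
      simp only [hnext]
      rw [dif_pos hlev]
      convert hlev.choose_spec.2 using 2
      push_cast; ring
  obtain ⟨z, hz, hmax⟩ := UpperSemicontinuousOn.exists_isMaxOn (nonempty_closedBall.2 hδ.le)
    (isCompact_closedBall y δ) (hu.1.mono hy)
  obtain ⟨k, hk⟩ := exists_nat_gt (u z)
  have hxk : x k ∈ closedBall y δ := mem_closedBall.2 (by linarith [hdist k, hR0 k (x k)])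
  have h1 : u (x k) ≤ u z := EReal.coe_le_coe_iff.1 (hmax hxk)
  have h2 := Real.add_one_le_exp ((k : ℝ) + m + 3)
  have h3 := hux k
  have h4 : (0 : ℝ) ≤ m := m.cast_nonneg
  linarith

end EuclideanSpace

theorem rippon_theoremB
    (n : ℕ) (hn : 2 ≤ n)
    (D : Set (EuclideanSpace ℝ (Fin n))) (hDopen : IsOpen D) (hDconn : IsConnected D)
    (φ : ℝ≥0∞ → ℝ≥0∞) (hφ : Monotone φ)
    (hφint : ∫⁻ t in Set.Ioi (1 : ℝ), (φ (ENNReal.ofReal t) ^ (1 / ((n : ℝ) - 1)))⁻¹ < ⊤)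
    (F : EuclideanSpace ℝ (Fin n) → ℝ≥0∞) (hF : UpperSemicontinuousOn F D)
    (𝓕 : Set (EuclideanSpace ℝ (Fin n) → ℝ))
    (h𝓕 : ∀ u ∈ 𝓕, (∀ x ∈ D, 0 ≤ u x) ∧
      SubharmonicOn (fun x => ((u x : ℝ) : EReal)) D ∧
      ∀ x ∈ D, ((u x : ℝ) : EReal) ≤ ((F x : ℝ≥0∞) : EReal))
    (hint : ∫⁻ x in D, φ (logPlusE (F x)) < ⊤) :
    (∀ x ∈ D, ∃ r > (0 : ℝ), ∃ C : ℝ, ∀ y ∈ closedBall x r ∩ D, ∀ u ∈ 𝓕, u y ≤ C) ∧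
    SubharmonicOn
      (fun x => Filter.limsup (fun y => ⨆ u ∈ 𝓕, ((u y : ℝ) : EReal)) (nhdsWithin x D)) D := by
  have hbdd : ∀ x ∈ D, ∃ r > (0 : ℝ), ∃ C : ℝ, ∀ y ∈ closedBall x r ∩ D, ∀ u ∈ 𝓕, u y ≤ C := by
    intro x hx
    obtain ⟨ε, hε, hball⟩ := Metric.isOpen_iff.1 hDopen x hx
    have hδ : 0 < ε / 3 := by positivity
    obtain ⟨C, hC⟩ := exists_uniform_bound hn hDopen hφ hφint hF hint hδ
    refine ⟨ε / 3, hδ, C, fun y hy u hu => ?_⟩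
    obtain ⟨hu0, hus, huF⟩ := h𝓕 u hu
    refine hC u hu0 hus (fun z hz => ?_) y ((closedBall_subset_ball' ?_).trans hball)
    · simpa using EReal.toENNReal_le_toENNReal (huF z hz)
    · linarith [mem_closedBall.1 hy.1]
  exact ⟨hbdd, subharmonicOn_limsup_iSup (by omega)
    (fun u hu => ⟨(h𝓕 u hu).1, (h𝓕 u hu).2.1⟩) hbdd⟩
end
end

section
/- Let u : D → [-∞, +∞) be Lebesgue measurable. Then u is nearly subharmonic if and only if there exists a function v, subharmonic in D, such that v ≥ u on D and v = u almost everywhere in D; moreover, in that case v equals the upper semicontinuous regularization u*(x) := limsup_{x'→x} u(x'). -/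
open MeasureTheory Metric Filter Set ENNReal

noncomputable section

theorem toENNReal_add_ofReal (e : EReal) {M : ℝ} (hM : 0 ≤ M) :
    e.toENNReal + ENNReal.ofReal M
      = (e + (M : EReal)).toENNReal + min (-e).toENNReal (ENNReal.ofReal M) := by
  induction e with
  | bot => simp
  | top => simp
  | coe x =>
    have h : ((x : EReal) + (M : EReal)) = ((x + M : ℝ) : EReal) := rfl
    have h' : -(x : EReal) = ((-x : ℝ) : EReal) := rfl
    simp only [h, h', EReal.toENNReal_of_ne_top (EReal.coe_ne_top _), EReal.toReal_coe]
    rcases le_total 0 x with hx | hx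
    · rw [ENNReal.ofReal_of_nonpos (p := -x) (by linarith), ← ENNReal.ofReal_add hx hM]
      simp
    · rw [ENNReal.ofReal_of_nonpos hx, ← ENNReal.ofReal_min]
      rcases le_total (x + M) 0 with h1 | h1
      · rw [ENNReal.ofReal_of_nonpos h1, min_eq_right (by linarith)]
      · rw [min_eq_left (by linarith), ← ENNReal.ofReal_add h1 (by linarith)]
        simp

theorem toENNReal_add_le_of_le_mul_sub {t : EReal} {c M : ℝ} (hc : 0 < c) (hM : 0 ≤ M)
    {P N N' W : ℝ≥0∞} (ht : t ≤ (c : EReal) * ((P : EReal) - (N : EReal))) (hN : N' ≤ N)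
    (h : ENNReal.ofReal c * P + ENNReal.ofReal M
      = ENNReal.ofReal c * W + ENNReal.ofReal c * N') :
    (t + (M : EReal)).toENNReal ≤ ENNReal.ofReal c * W := by
  induction N with
  | top =>
    have : t = ⊥ := by simpa [EReal.coe_mul_bot_of_pos hc] using ht
    simp [this]
  | coe N =>
    induction W with
    | top => simp [hc]
    | coe W =>
      lift N' to NNReal using (hN.trans_lt coe_lt_top).ne
      induction P with
      | top =>
        simp [hc, ENNReal.mul_top] at h
        exact absurd h.symm (by finiteness)
      | coe P =>
        lift c to NNReal using hc.le
        lift M to NNReal using hM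
        simp only [ENNReal.ofReal_coe_nnreal] at h ⊢
        norm_cast at h hN
        have h2 := congrArg NNReal.toReal h
        push_cast at h2
        have h3 : (N' : ℝ) ≤ N := hN
        induction t with
        | bot => simp
        | top => exact absurd ht (not_le.2 (by
            have : ((c : ℝ) : EReal) * (((P : ℝ≥0∞) : EReal) - ((N : ℝ≥0∞) : EReal))
              = (((c : ℝ) * (P - N) : ℝ) : EReal) := rfl
            rw [this]; exact EReal.coe_lt_top _))
        | coe t =>
          have : ((c : ℝ) : EReal) * (((P : ℝ≥0∞) : EReal) - ((N : ℝ≥0∞) : EReal))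
              = (((c : ℝ) * (P - N) : ℝ) : EReal) := rfl
          rw [this, EReal.coe_le_coe_iff] at ht
          rw [← EReal.coe_add, EReal.toENNReal_of_ne_top (EReal.coe_ne_top _), EReal.toReal_coe,
            ← ENNReal.coe_mul, ← ENNReal.ofReal_coe_nnreal]
          apply ENNReal.ofReal_le_ofReal
          push_cast
          nlinarith [c.2]

theorem le_mul_sub_of_forall_toENNReal_add_le {t : EReal} {c : ℝ} (hc : 0 < c)
    {P N : ℝ≥0∞} {N' W : ℕ → ℝ≥0∞} (hP : P ≠ ⊤)
    (ht : ∀ k : ℕ, (t + ((k : ℝ) : EReal)).toENNReal ≤ ENNReal.ofReal c * W k)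
    (hN : N = ⨆ k, N' k)
    (h : ∀ k : ℕ, ENNReal.ofReal c * P + ENNReal.ofReal k
      = ENNReal.ofReal c * W k + ENNReal.ofReal c * N' k) :
    t ≤ (c : EReal) * ((P : EReal) - (N : EReal)) := by
  have hc0 : ENNReal.ofReal c ≠ 0 := by simpa using hc
  lift P to NNReal using hP
  lift c to NNReal using hc.le
  have hcpos : (0 : ℝ) < c := hc
  have hfin : ∀ k, W k ≠ ⊤ ∧ N' k ≠ ⊤ := by
    intro k
    constructor <;> intro hk <;> have h1 := h k <;>
      simp only [hk, ENNReal.mul_top hc0, top_add, add_top] at h1 <;>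
      exact absurd h1 (by finiteness)
  induction t with
  | bot => simp
  | top =>
    exact absurd (top_le_iff.1 (by simpa using ht 0)) (ENNReal.mul_ne_top (by simp) (hfin 0).1)
  | coe t =>
    have key : ∀ k, N' k ≤ ENNReal.ofReal (P - t / c) := by
      intro k
      have h1 := h k
      have h2 := ht k
      obtain ⟨hw, hn⟩ := hfin k
      generalize W k = w at *
      generalize N' k = n at *
      lift w to NNReal using hw
      lift n to NNReal using hn
      rw [← EReal.coe_add, EReal.toENNReal_of_ne_top (EReal.coe_ne_top _), EReal.toReal_coe,
        ENNReal.ofReal_coe_nnreal, ← ENNReal.coe_mul, ← ENNReal.ofReal_coe_nnreal,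
        ENNReal.ofReal_le_ofReal_iff (by positivity)] at h2
      simp only [ENNReal.ofReal_coe_nnreal, ENNReal.ofReal_natCast] at h1
      norm_cast at h1
      have h3 := congrArg NNReal.toReal h1
      push_cast at h2 h3
      rw [← ENNReal.ofReal_coe_nnreal]
      apply ENNReal.ofReal_le_ofReal
      rw [le_sub_iff_add_le, ← le_sub_iff_add_le', div_le_iff₀ hcpos]
      linarith
    have hN2 : N ≤ ENNReal.ofReal (P - t / c) := hN ▸ iSup_le key
    have hpos : 0 ≤ P - t / c := by
      have h1 := h 0
      have h2 := ht 0
      obtain ⟨hw, -⟩ := hfin 0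
      generalize W 0 = w at *
      lift w to NNReal using hw
      simp only [Nat.cast_zero, EReal.coe_zero, add_zero, ENNReal.ofReal_coe_nnreal,
        ENNReal.ofReal_zero] at h1 h2
      have h3 : (t : EReal).toENNReal ≤ ((c * P : NNReal) : ℝ≥0∞) := by
        refine h2.trans ?_
        rw [ENNReal.coe_mul, h1]
        exact le_self_add
      rw [EReal.toENNReal_of_ne_top (EReal.coe_ne_top _), EReal.toReal_coe,
        ← ENNReal.ofReal_coe_nnreal, ENNReal.ofReal_le_ofReal_iff (by positivity)] at h3
      push_cast at h3
      rw [sub_nonneg, div_le_iff₀ hcpos]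
      linarith
    lift N to NNReal using (hN2.trans_lt ofReal_lt_top).ne
    rw [← ENNReal.ofReal_coe_nnreal, ENNReal.ofReal_le_ofReal_iff hpos] at hN2
    have : ((c : ℝ) : EReal) * (((P : ℝ≥0∞) : EReal) - ((N : ℝ≥0∞) : EReal))
              = (((c : ℝ) * (P - N) : ℝ) : EReal) := rfl
    rw [this, EReal.coe_le_coe_iff]
    rw [le_sub_iff_add_le, ← le_sub_iff_add_le', div_le_iff₀ hcpos] at hN2
    linarith

section Mean

variable {α : Type*} [MeasurableSpace α] {μ : Measure α} {u : α → EReal}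

theorem mul_lintegral_toENNReal_add {c M : ℝ} (hu : AEMeasurable u μ) (hM : 0 ≤ M)
    (hμ : ENNReal.ofReal c * μ univ = 1) :
    ENNReal.ofReal c * ∫⁻ y, (u y).toENNReal ∂μ + ENNReal.ofReal M
      = ENNReal.ofReal c * ∫⁻ y, (u y + (M : EReal)).toENNReal ∂μ
        + ENNReal.ofReal c * ∫⁻ y, min (-(u y)).toENNReal (ENNReal.ofReal M) ∂μ := by
  have hM' : ENNReal.ofReal M = ENNReal.ofReal c * ∫⁻ _, ENNReal.ofReal M ∂μ := by
    rw [lintegral_const, mul_left_comm, hμ, mul_one]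
  have hneg : AEMeasurable (fun y => min (-(u y)).toENNReal (ENNReal.ofReal M)) μ :=
    (measurable_ereal_toENNReal.comp_aemeasurable hu.neg).min aemeasurable_const
  nth_rewrite 1 [hM']
  rw [← mul_add, ← mul_add, ← lintegral_add_right' _ hneg,
    ← lintegral_add_right _ measurable_const]
  simp_rw [toENNReal_add_ofReal _ hM]

theorem toENNReal_add_le_mul_lintegral {t : EReal} {c M : ℝ} (hc : 0 < c) (hM : 0 ≤ M)
    (hu : AEMeasurable u μ) (hμ : ENNReal.ofReal c * μ univ = 1)
    (ht : t ≤ (c : EReal) * (((∫⁻ y, (u y).toENNReal ∂μ : ℝ≥0∞) : EReal)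
      - ((∫⁻ y, (-(u y)).toENNReal ∂μ : ℝ≥0∞) : EReal))) :
    (t + (M : EReal)).toENNReal ≤ ENNReal.ofReal c * ∫⁻ y, (u y + (M : EReal)).toENNReal ∂μ :=
  toENNReal_add_le_of_le_mul_sub hc hM ht (lintegral_mono fun _ => min_le_left _ _)
    (mul_lintegral_toENNReal_add hu hM hμ)

theorem le_mul_sub_of_forall_le_lintegral {t : EReal} {c : ℝ} (hc : 0 < c)
    (hu : AEMeasurable u μ) (hμ : ENNReal.ofReal c * μ univ = 1)
    (hP : ∫⁻ y, (u y).toENNReal ∂μ ≠ ⊤)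
    (ht : ∀ k : ℕ, (t + ((k : ℝ) : EReal)).toENNReal
      ≤ ENNReal.ofReal c * ∫⁻ y, (u y + ((k : ℝ) : EReal)).toENNReal ∂μ) :
    t ≤ (c : EReal) * (((∫⁻ y, (u y).toENNReal ∂μ : ℝ≥0∞) : EReal)
      - ((∫⁻ y, (-(u y)).toENNReal ∂μ : ℝ≥0∞) : EReal)) := by
  refine le_mul_sub_of_forall_toENNReal_add_le hc hP ht ?_
    fun k => mul_lintegral_toENNReal_add hu k.cast_nonneg hμ
  rw [← lintegral_iSup']
  · refine lintegral_congr fun y => ?_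
    simp only [ENNReal.ofReal_natCast]
    rw [← inf_iSup_eq, ENNReal.iSup_natCast, inf_top_eq]
  · exact fun k => (measurable_ereal_toENNReal.comp_aemeasurable hu.neg).min aemeasurable_const
  · refine ae_of_all _ fun y j k hjk => min_le_min le_rfl ?_
    exact ENNReal.ofReal_le_ofReal (by exact_mod_cast hjk)

end Mean

section EuclideanBalls

variable {n : ℕ} {D : Set (EuclideanSpace ℝ (Fin n))} {u v : EuclideanSpace ℝ (Fin n) → EReal}

theorem nuBall_pos (n : ℕ) : 0 < nuBall n :=
  ENNReal.toReal_pos (measure_ball_pos _ _ one_pos).ne' measure_ball_lt_top.ne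

theorem one_div_nuBall_mul_pow_pos (n : ℕ) {r : ℝ} (hr : 0 < r) : 0 < 1 / (nuBall n * r ^ n) := by
  have := nuBall_pos n
  positivity

theorem volume_ball_eq_ofReal (x : EuclideanSpace ℝ (Fin n)) {r : ℝ} (hr : 0 < r) :
    volume (ball x r) = ENNReal.ofReal (nuBall n * r ^ n) := by
  rw [Measure.addHaar_ball_of_pos _ _ hr, finrank_euclideanSpace_fin, mul_comm (nuBall n),
    ENNReal.ofReal_mul (by positivity), nuBall, ENNReal.ofReal_toReal measure_ball_lt_top.ne]

theorem ofReal_one_div_nuBall_mul_volume (x : EuclideanSpace ℝ (Fin n)) {r : ℝ} (hr : 0 < r) :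
    ENNReal.ofReal (1 / (nuBall n * r ^ n)) * volume.restrict (ball x r) univ = 1 := by
  have := nuBall_pos n
  rw [Measure.restrict_apply_univ, volume_ball_eq_ofReal x hr, ← ENNReal.ofReal_mul (by positivity),
    one_div_mul_cancel (by positivity), ENNReal.ofReal_one]

theorem ofReal_one_div_nuBall_eq_inv (x : EuclideanSpace ℝ (Fin n)) {r : ℝ} (hr : 0 < r) :
    ENNReal.ofReal (1 / (nuBall n * r ^ n)) = (volume (closedBall x r))⁻¹ := by
  have := nuBall_pos n
  rw [Measure.addHaar_closedBall _ _ hr.le, ← Measure.addHaar_ball_of_pos _ x hr,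
    volume_ball_eq_ofReal x hr, one_div,
    ENNReal.ofReal_inv_of_pos (by positivity)]

theorem aemeasurable_restrict_of_subset (hD : IsOpen D) (hu : Measurable fun x : D => u x)
    {A : Set (EuclideanSpace ℝ (Fin n))} (hA : A ⊆ D) : AEMeasurable u (volume.restrict A) :=
  (aemeasurable_restrict_of_measurable_subtype hD.measurableSet hu).mono_set hA

theorem PosPartLocInt.lintegral_ball_ne_top (h : PosPartLocInt u D)
    {x : EuclideanSpace ℝ (Fin n)} {r : ℝ} (hb : closedBall x r ⊆ D) :
    ∫⁻ y in ball x r, (u y).toENNReal ≠ ⊤ :=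
  ((lintegral_mono_set ball_subset_closedBall).trans_lt
    (h _ hb (isCompact_closedBall x r))).ne

theorem PosPartLocInt.lintegral_closedBall_add_ne_top (h : PosPartLocInt u D)
    {x : EuclideanSpace ℝ (Fin n)} {r : ℝ} (hb : closedBall x r ⊆ D) (M : ℝ) :
    ∫⁻ y in closedBall x r, (u y + (M : EReal)).toENNReal ≠ ⊤ := by
  have h1 := h _ hb (isCompact_closedBall x r)
  refine ((lintegral_mono fun _ => EReal.toENNReal_add_le).trans_lt ?_).ne
  rw [lintegral_add_right _ measurable_const, lintegral_const, Measure.restrict_apply_univ]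
  exact ENNReal.add_lt_top.2 ⟨h1, ENNReal.mul_lt_top (by simp [lt_top_iff_ne_top])
    measure_closedBall_lt_top⟩

theorem toENNReal_add_le_of_le_mean (hD : IsOpen D) (hu : Measurable fun x : D => u x)
    {x : EuclideanSpace ℝ (Fin n)} {r : ℝ} (hr : 0 < r) (hb : closedBall x r ⊆ D) {t : EReal}
    (ht : t ≤ ((1 / (nuBall n * r ^ n) : ℝ) : EReal) * erealIntegralOn (ball x r) u)
    {M : ℝ} (hM : 0 ≤ M) :
    (t + (M : EReal)).toENNReal ≤ ENNReal.ofReal (1 / (nuBall n * r ^ n)) *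
      ∫⁻ y in ball x r, (u y + (M : EReal)).toENNReal :=
  toENNReal_add_le_mul_lintegral (one_div_nuBall_mul_pow_pos n hr) hM
    (aemeasurable_restrict_of_subset hD hu (ball_subset_closedBall.trans hb))
    (ofReal_one_div_nuBall_mul_volume x hr) ht

theorem erealIntegralOn_congr_ae {A : Set (EuclideanSpace ℝ (Fin n))}
    (h : ∀ᵐ x ∂(volume.restrict D), v x = u x) (hA : A ⊆ D) :
    erealIntegralOn A v = erealIntegralOn A u := by
  have h' : ∀ᵐ x ∂(volume.restrict A), v x = u x := ae_restrict_of_ae_restrict_of_subset hA h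
  unfold erealIntegralOn
  rw [lintegral_congr_ae (h'.mono fun x hx => congrArg erealPos hx),
    lintegral_congr_ae (h'.mono fun x hx => congrArg (fun e => erealPos (-e)) hx)]

theorem EReal.le_coe_sub_of_toENNReal_add_le {t : EReal} {M : ℝ} {a : ℝ≥0∞}
    (h : (t + (M : EReal)).toENNReal ≤ a) : t ≤ (a : EReal) - (M : EReal) := by
  rw [EReal.le_sub_iff_add_le (.inl (EReal.coe_ne_bot _)) (.inl (EReal.coe_ne_top _))]
  exact (EReal.coe_toENNReal_eq_max ▸ le_max_right _ _).trans
    (EReal.coe_ennreal_le_coe_ennreal_iff.2 h)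

theorem EReal.toENNReal_add_le_of_le_coe_sub {t : EReal} {M : ℝ} {a : ℝ≥0∞}
    (h : t ≤ (a : EReal) - (M : EReal)) : (t + (M : EReal)).toENNReal ≤ a := by
  rw [EReal.le_sub_iff_add_le (.inl (EReal.coe_ne_bot _)) (.inl (EReal.coe_ne_top _))] at h
  simpa using EReal.toENNReal_le_toENNReal h

theorem le_limsup_nhdsWithin {x : EuclideanSpace ℝ (Fin n)} (hx : x ∈ D) :
    u x ≤ limsup u (nhdsWithin x D) := by
  refine le_limsup_of_frequently_le ?_
  exact fun h => (h.self_of_nhdsWithin hx) le_rfl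

theorem upperSemicontinuousOn_limsup_nhdsWithin :
    UpperSemicontinuousOn (fun x => limsup u (nhdsWithin x D)) D := by
  intro x _ a ha
  obtain ⟨b, hb, hba⟩ := exists_between ha
  have h := eventually_eventually_nhdsWithin.2 (eventually_lt_of_limsup_lt hb)
  filter_upwards [h] with y hy
  exact (limsup_le_of_le (h := hy.mono fun _ => le_of_lt)).trans_lt hba

theorem NearlySubharmonicOn.limsup_add_le_mean (hD : IsOpen D) (hu : NearlySubharmonicOn u D)
    {x : EuclideanSpace ℝ (Fin n)} {r : ℝ} (hr : 0 < r) (hb : closedBall x r ⊆ D)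
    {M : ℝ} (hM : 0 ≤ M) :
    (limsup u (nhdsWithin x D) + (M : EReal)).toENNReal ≤
      ENNReal.ofReal (1 / (nuBall n * r ^ n)) *
        ∫⁻ y in ball x r, (u y + (M : EReal)).toENNReal := by
  obtain ⟨hmeas, -, hloc, hmean⟩ := hu
  set W := ∫⁻ y in ball x r, (u y + (M : EReal)).toENNReal
  have hWtop : W ≠ ⊤ := ((lintegral_mono_set ball_subset_closedBall).trans_lt
    (hloc.lintegral_closedBall_add_ne_top hb M).lt_top).ne
  have key : ∀ s ∈ Ioo 0 r, (limsup u (nhdsWithin x D) + (M : EReal)).toENNReal ≤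
      ENNReal.ofReal (1 / (nuBall n * s ^ n)) * W := by
    rintro s ⟨hs0, hsr⟩
    apply EReal.toENNReal_add_le_of_le_coe_sub
    refine limsup_le_of_le (h := ?_)
    filter_upwards [mem_nhdsWithin_of_mem_nhds (ball_mem_nhds x (sub_pos.2 hsr))] with y hy
    apply EReal.le_coe_sub_of_toENNReal_add_le
    have hsub : closedBall y s ⊆ ball x r := by
      intro z hz
      rw [mem_ball] at hy ⊢
      rw [mem_closedBall] at hz
      linarith [dist_triangle z y x]
    have hyD := hsub.trans (ball_subset_closedBall.trans hb)
    refine (toENNReal_add_le_of_le_mean hD hmeas hs0 hyD (hmean y s hs0 hyD) hM).trans ?_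
    exact mul_le_mul_right (lintegral_mono_set (ball_subset_closedBall.trans hsub)) _
  have hlim : Tendsto (fun s : ℝ => ENNReal.ofReal (1 / (nuBall n * s ^ n)) * W)
      (nhdsWithin r (Iio r)) (nhds (ENNReal.ofReal (1 / (nuBall n * r ^ n)) * W)) := by
    refine ENNReal.Tendsto.mul_const ?_ (.inr hWtop)
    refine ENNReal.tendsto_ofReal ?_
    have hc : ContinuousAt (fun s : ℝ => 1 / (nuBall n * s ^ n)) r := by
      have := nuBall_pos n
      exact ContinuousAt.div (by fun_prop) (by fun_prop) (by positivity)
    exact hc.tendsto.mono_left nhdsWithin_le_nhds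
  exact ge_of_tendsto hlim (Filter.mem_of_superset (Ioo_mem_nhdsLT hr) key)

theorem NearlySubharmonicOn.limsup_lt_top (hD : IsOpen D) (hu : NearlySubharmonicOn u D)
    {x : EuclideanSpace ℝ (Fin n)} (hx : x ∈ D) : limsup u (nhdsWithin x D) < ⊤ := by
  obtain ⟨r, hr, hb⟩ := nhds_basis_closedBall.mem_iff.1 (hD.mem_nhds hx)
  have h := hu.limsup_add_le_mean hD hr hb le_rfl
  refine lt_top_iff_ne_top.2 fun htop => ?_
  simp only [htop, EReal.coe_zero, add_zero, EReal.toENNReal_top, top_le_iff] at h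
  exact ENNReal.mul_ne_top ofReal_ne_top (hu.2.2.1.lintegral_ball_ne_top hb) h

theorem EReal.le_of_forall_toENNReal_add_natCast_le {s t : EReal} (hs : s < ⊤)
    (h : ∀ k : ℕ, (s + ((k : ℝ) : EReal)).toENNReal ≤ (t + ((k : ℝ) : EReal)).toENNReal) :
    s ≤ t := by
  induction s with
  | bot => exact bot_le
  | top => exact absurd hs (lt_irrefl _)
  | coe s =>
    obtain ⟨k, hk⟩ := exists_nat_gt (-s)
    have hpos : (0 : EReal) < (s : EReal) + ((k : ℝ) : EReal) := by
      rw [← EReal.coe_add]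
      exact_mod_cast (by linarith : (0 : ℝ) < s + k)
    have h1 := h k
    have ht : 0 < t + ((k : ℝ) : EReal) :=
      EReal.toENNReal_pos_iff.1 ((EReal.toENNReal_pos_iff.2 hpos).trans_le h1)
    have h2 : (s : EReal) + ((k : ℝ) : EReal) ≤ t + ((k : ℝ) : EReal) := by
      rw [← EReal.coe_toENNReal hpos.le, ← EReal.coe_toENNReal ht.le]
      exact_mod_cast h1
    rwa [← EReal.le_sub_iff_add_le (.inl (EReal.coe_ne_bot _)) (.inl (EReal.coe_ne_top _)),
      EReal.add_sub_cancel_right] at h2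

theorem NearlySubharmonicOn.ae_limsup_le (hD : IsOpen D) (hu : NearlySubharmonicOn u D) :
    ∀ᵐ x ∂(volume.restrict D), limsup u (nhdsWithin x D) ≤ u x := by
  rw [ae_restrict_iff' hD.measurableSet, ae_iff]
  refine measure_null_of_locally_null _ fun x₀ hx₀ => ?_
  simp only [mem_ofPred_eq, Classical.not_imp] at hx₀
  obtain ⟨r₀, hr₀, hb₀⟩ := nhds_basis_closedBall.mem_iff.1 (hD.mem_nhds hx₀.1)
  refine ⟨_, inter_mem self_mem_nhdsWithin (mem_nhdsWithin_of_mem_nhds (ball_mem_nhds x₀ hr₀)), ?_⟩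
  let f (k : ℕ) : EuclideanSpace ℝ (Fin n) → ℝ≥0∞ :=
    (closedBall x₀ r₀).indicator fun y => (u y + ((k : ℝ) : EReal)).toENNReal
  have hae : ∀ᵐ x, ∀ k : ℕ, Tendsto (fun a => (∫⁻ y in a, f k y) / volume a)
      ((Besicovitch.vitaliFamily volume).filterAt x) (nhds (f k x)) := by
    refine ae_all_iff.2 fun k => ?_
    refine VitaliFamily.ae_tendsto_lintegral_div _ ?_ ?_
    · refine (aemeasurable_indicator_iff measurableSet_closedBall).2 ?_
      exact measurable_ereal_toENNReal.comp_aemeasurable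
        ((aemeasurable_restrict_of_subset hD hu.1 hb₀).add_const _)
    · rw [lintegral_indicator measurableSet_closedBall]
      exact hu.2.2.1.lintegral_closedBall_add_ne_top hb₀ k
  refine measure_mono_null ?_ (ae_iff.1 hae)
  rintro x ⟨hx, hxb⟩ hlim
  simp only [mem_ofPred_eq, Classical.not_imp] at hx
  refine hx.2 (EReal.le_of_forall_toENNReal_add_natCast_le (hu.limsup_lt_top hD hx.1) fun k => ?_)
  have hfx : f k x = (u x + ((k : ℝ) : EReal)).toENNReal :=
    indicator_of_mem (ball_subset_closedBall hxb) _
  rw [← hfx]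
  refine ge_of_tendsto ((hlim k).comp (Besicovitch.tendsto_filterAt volume x)) ?_
  have hδ : 0 < r₀ - dist x x₀ := sub_pos.2 hxb
  filter_upwards [Ioc_mem_nhdsGT hδ] with r hr
  have hsub : closedBall x r ⊆ closedBall x₀ r₀ :=
    closedBall_subset_closedBall' (by linarith [hr.2])
  refine (hu.limsup_add_le_mean hD hr.1 (hsub.trans hb₀) k.cast_nonneg).trans ?_
  rw [Function.comp_apply, ofReal_one_div_nuBall_eq_inv x hr.1, ENNReal.div_eq_inv_mul]
  refine mul_le_mul_right ((lintegral_mono_set ball_subset_closedBall).trans (le_of_eq ?_)) _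
  exact setLIntegral_congr_fun measurableSet_closedBall fun y hy =>
    (indicator_of_mem (hsub hy) fun y => (u y + ((k : ℝ) : EReal)).toENNReal).symm

theorem NearlySubharmonicOn.ae_limsup_eq (hD : IsOpen D) (hu : NearlySubharmonicOn u D) :
    ∀ᵐ x ∂(volume.restrict D), limsup u (nhdsWithin x D) = u x := by
  filter_upwards [hu.ae_limsup_le hD, ae_restrict_mem hD.measurableSet] with x hx hxD
  exact hx.antisymm (le_limsup_nhdsWithin hxD)

theorem NearlySubharmonicOn.subharmonicOn_limsup (hD : IsOpen D) (hu : NearlySubharmonicOn u D) :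
    SubharmonicOn (fun x => limsup u (nhdsWithin x D)) D := by
  refine ⟨upperSemicontinuousOn_limsup_nhdsWithin, fun x hx => hu.limsup_lt_top hD hx,
    fun x r hr hb => ?_⟩
  have hsub : ball x r ⊆ D := ball_subset_closedBall.trans hb
  rw [erealIntegralOn_congr_ae (hu.ae_limsup_eq hD) hsub]
  exact le_mul_sub_of_forall_le_lintegral (one_div_nuBall_mul_pow_pos n hr)
    (aemeasurable_restrict_of_subset hD hu.1 hsub) (ofReal_one_div_nuBall_mul_volume x hr)
    (hu.2.2.1.lintegral_ball_ne_top hb)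
    fun k => hu.limsup_add_le_mean hD hr hb k.cast_nonneg

theorem SubharmonicOn.posPartLocInt_of_le (hv : SubharmonicOn v D) (huv : ∀ x ∈ D, u x ≤ v x) :
    PosPartLocInt u D := by
  intro E hE hEc
  rcases E.eq_empty_or_nonempty with rfl | hne
  · simp
  obtain ⟨a, ha, hmax⟩ := (hv.1.mono hE).exists_isMaxOn hne hEc
  refine (setLIntegral_mono' hEc.measurableSet
    (g := fun _ => (v a).toENNReal) fun x hx => ?_).trans_lt ?_
  · exact EReal.toENNReal_le_toENNReal ((huv x (hE hx)).trans (hmax hx))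
  · rw [lintegral_const, Measure.restrict_apply_univ]
    exact ENNReal.mul_lt_top (EReal.toENNReal_ne_top_iff.2 (hv.2.1 a (hE ha)).ne).lt_top
      hEc.measure_lt_top

theorem SubharmonicOn.nearlySubharmonicOn_of_ae_eq (hv : SubharmonicOn v D)
    (hmeas : Measurable fun x : D => u x) (huv : ∀ x ∈ D, u x ≤ v x)
    (hae : ∀ᵐ x ∂(volume.restrict D), v x = u x) : NearlySubharmonicOn u D := by
  refine ⟨hmeas, fun x hx => (huv x hx).trans_lt (hv.2.1 x hx), hv.posPartLocInt_of_le huv,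
    fun x r hr hb => ?_⟩
  rw [← erealIntegralOn_congr_ae hae (ball_subset_closedBall.trans hb)]
  exact (huv x (hb (mem_closedBall_self hr.le))).trans (hv.2.2 x r hr hb)

theorem SubharmonicOn.eq_limsup_of_ae_eq (hD : IsOpen D) (hv : SubharmonicOn v D)
    (hmeas : Measurable fun x : D => u x) (huv : ∀ x ∈ D, u x ≤ v x)
    (hae : ∀ᵐ x ∂(volume.restrict D), v x = u x) {x : EuclideanSpace ℝ (Fin n)} (hx : x ∈ D) :
    v x = limsup u (nhdsWithin x D) := by
  refine le_antisymm (le_of_not_gt fun hlt => ?_) (le_of_forall_gt_imp_ge_of_dense fun a ha => ?_)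
  · obtain ⟨b, hb, hbv⟩ := EReal.lt_iff_exists_real_btwn.1 hlt
    have hev := eventually_lt_of_limsup_lt hb
    rw [hD.nhdsWithin_eq hx] at hev
    obtain ⟨r, hr, hball⟩ := nhds_basis_closedBall.mem_iff.1
      (inter_mem hev (hD.mem_nhds hx))
    have hbD : closedBall x r ⊆ D := fun y hy => (hball hy).2
    have hmean := hv.2.2 x r hr hbD
    rw [erealIntegralOn_congr_ae hae (ball_subset_closedBall.trans hbD)] at hmean
    have hM : (0 : ℝ) ≤ |b| := abs_nonneg b
    have h1 := toENNReal_add_le_of_le_mean hD hmeas hr hbD hmean hM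
    have h2 : ∫⁻ y in ball x r, (u y + ((|b| : ℝ) : EReal)).toENNReal
        ≤ ∫⁻ _ in ball x r, ((b : EReal) + ((|b| : ℝ) : EReal)).toENNReal :=
      setLIntegral_mono' measurableSet_ball fun y hy => EReal.toENNReal_le_toENNReal
        (add_le_add_left (hball (ball_subset_closedBall hy)).1.le _)
    rw [lintegral_const] at h2
    have h3 := h1.trans (mul_le_mul_right h2 _)
    rw [mul_left_comm, ofReal_one_div_nuBall_mul_volume x hr, mul_one] at h3
    have h4 := EReal.le_coe_sub_of_toENNReal_add_le h3
    rw [EReal.coe_toENNReal (by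
      rw [← EReal.coe_add]
      exact_mod_cast (by linarith [neg_abs_le b] : (0 : ℝ) ≤ b + |b|))] at h4
    rw [EReal.add_sub_cancel_right] at h4
    exact absurd h4 (not_le.2 hbv)
  · refine limsup_le_of_le (h := ?_)
    filter_upwards [hv.1 x hx a ha, self_mem_nhdsWithin] with y hy hyD
    exact (huv y hyD).trans hy.le

end EuclideanBalls

theorem nearly_subharmonic_iff_subharmonic_majorant
    (n : ℕ) (hn : 2 ≤ n)
    (D : Set (EuclideanSpace ℝ (Fin n))) (hDopen : IsOpen D) (hDconn : IsConnected D)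
    (u : EuclideanSpace ℝ (Fin n) → EReal)
    (hmeas : Measurable (D.restrict u)) (hlt : ∀ x ∈ D, u x < ⊤) :
    (NearlySubharmonicOn u D ↔
      ∃ v : EuclideanSpace ℝ (Fin n) → EReal, SubharmonicOn v D ∧ (∀ x ∈ D, u x ≤ v x) ∧
        ∀ᵐ x ∂(volume.restrict D), v x = u x) ∧
    ∀ v : EuclideanSpace ℝ (Fin n) → EReal, SubharmonicOn v D → (∀ x ∈ D, u x ≤ v x) →
      (∀ᵐ x ∂(volume.restrict D), v x = u x) →
      ∀ x ∈ D, v x = Filter.limsup u (nhdsWithin x D) := by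
  refine ⟨⟨fun hu => ⟨fun x => limsup u (nhdsWithin x D), hu.subharmonicOn_limsup hDopen,
    fun x hx => le_limsup_nhdsWithin hx, hu.ae_limsup_eq hDopen⟩, ?_⟩, ?_⟩
  · rintro ⟨v, hv, huv, hae⟩
    exact hv.nearlySubharmonicOn_of_ae_eq hmeas huv hae
  · intro v hv huv hae x hx
    exact hv.eq_limsup_of_ae_eq hDopen hmeas huv hae hx
end
end
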